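/- Suppose the nonempty family 𝒜 of subsets of ℕ contains two r.e.-separable sets, i.e. sets A₁ and A₂ such that for some disjoint recursively enumerable sets C, D ⊆ ℕ one has A₁ ⊆ C and A₂ ⊆ D. Then {{0},{1}} ≤_L 𝒜 (i.e. the double-negation operator, which is the basic local operator induced by the family {{0},{1}}, lies below L(G_𝒜)). -/

import Mathlib

open scoped Classical

/-- Kleene application: value of the `e`-th partial recursive function at `x`. -/
def kleene (e x : ℕ) : Part ℕ := (Denumerable.ofNat Nat.Partrec.Code e).eval x

/-- `A ∧ B = {⟨a,b⟩ | a ∈ A, b ∈ B}`. -/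
def setAnd (A B : Set ℕ) : Set ℕ := {x | ∃ a ∈ A, ∃ b ∈ B, x = Nat.pair a b}

/-- `A → B = {e | ∀ a ∈ A, e·a is defined and e·a ∈ B}`. -/
def setImp (A B : Set ℕ) : Set ℕ := {e | ∀ a ∈ A, ∃ v ∈ kleene e a, v ∈ B}

/-- `E(f) = ⋂_{p,q} ((p → q) → (f p → f q))`. -/
def Efun (f : Set ℕ → Set ℕ) : Set ℕ :=
  ⋂ (p : Set ℕ) (q : Set ℕ), setImp (setImp p q) (setImp (f p) (f q))

/-- `L(f)(p) = ⋂_q (((p → q) ∧ (f q → q)) → q)`. -/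
def Lop (f : Set ℕ → Set ℕ) (p : Set ℕ) : Set ℕ :=
  ⋂ (q : Set ℕ), setImp (setAnd (setImp p q) (setImp (f q) q)) q

/-- `L'(f)(p) = ⋂ {q | {0} ∧ p ⊆ q and {1} ∧ f q ⊆ q}`. -/
def L' (f : Set ℕ → Set ℕ) (p : Set ℕ) : Set ℕ :=
  ⋂₀ {q : Set ℕ | setAnd {0} p ⊆ q ∧ setAnd {1} (f q) ⊆ q}

/-- A sight: either `NIL` or a pair `(A, σ)` with `σ` assigning a sight to each `a ∈ A`. -/
inductive Sight : Type
  | nil : Sight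
  | node (A : Set ℕ) (σ : (a : ℕ) → a ∈ A → Sight) : Sight

/-- `S` is a `(z,θ,p)`-dedicated sight. -/
def Dedicated (B : Set ℕ) (θ : ℕ → Set (Set ℕ)) (p : Set ℕ) : ℕ → Sight → Prop
  | z, .nil => ∃ y ∈ p, z = Nat.pair 0 y
  | z, .node A σ => ∃ n ∈ B, ∃ e : ℕ, z = Nat.pair 1 (Nat.pair n e) ∧ A ∈ θ n ∧
      ∀ a (ha : a ∈ A), ∃ v ∈ kleene e a, Dedicated B θ p v (σ a ha)

/-- The tree `Tr(S)` of a sight, as a predicate on (finite) sequences. -/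
inductive InTr : Sight → List ℕ → Prop
  | nil : InTr Sight.nil []
  | emptyNode (A : Set ℕ) (σ : (a : ℕ) → a ∈ A → Sight) (hA : A = ∅) :
      InTr (Sight.node A σ) []
  | cons (A : Set ℕ) (σ : (a : ℕ) → a ∈ A → Sight) (a : ℕ) (ha : a ∈ A)
      (t : List ℕ) (h : InTr (σ a ha) t) : InTr (Sight.node A σ) (a :: t)

/-- The good leaves of (the tree of) a sight. -/
inductive IsGoodLeaf : Sight → List ℕ → Prop
  | nil : IsGoodLeaf Sight.nil []
  | cons (A : Set ℕ) (σ : (a : ℕ) → a ∈ A → Sight) (a : ℕ) (ha : a ∈ A)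
      (t : List ℕ) (h : IsGoodLeaf (σ a ha) t) : IsGoodLeaf (Sight.node A σ) (a :: t)

/-- `s` is a leaf of `Tr(S)`. -/
def IsLeaf (S : Sight) (s : List ℕ) : Prop := InTr S s ∧ ∀ a : ℕ, ¬ InTr S (s ++ [a])

/-- `Out_S(s) = {a | s∗⟨a⟩ ∈ Tr(S)}`. -/
def OutS (S : Sight) (s : List ℕ) : Set ℕ := {a | InTr S (s ++ [a])}

/-- A sight is degenerate if some leaf of its tree is not a good leaf. -/
def Degenerate (S : Sight) : Prop := ∃ s, IsLeaf S s ∧ ¬ IsGoodLeaf S s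

/-- A sight is on a family `𝒜` if all its outsets at non-leaves belong to `𝒜`. -/
def SightOn (S : Sight) (𝒜 : Set (Set ℕ)) : Prop :=
  ∀ s, InTr S s → ¬ IsLeaf S s → OutS S s ∈ 𝒜

/-- `S` is `(w,θ,p)`-supporting. -/
def Supporting (B : Set ℕ) (θ : ℕ → Set (Set ℕ)) (p : Set ℕ) (w : ℕ) (S : Sight) : Prop :=
  (∀ s, IsGoodLeaf S s → ∃ y ∈ p, Nat.pair 0 y ∈ kleene w (Encodable.encode s)) ∧
  (∀ s, InTr S s → ¬ IsGoodLeaf S s →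
    ∃ n ∈ B, Nat.pair 1 n ∈ kleene w (Encodable.encode s) ∧ OutS S s ∈ θ n)

/-- `z` is r-defined on `S` if `S` is `(z,θ,ℕ)`-dedicated for some `θ`. -/
def RDefined (z : ℕ) (S : Sight) : Prop :=
  ∃ (B : Set ℕ) (θ : ℕ → Set (Set ℕ)), B.Nonempty ∧ (∀ n ∈ B, (θ n).Nonempty) ∧
    Dedicated B θ Set.univ z S

/-- `G_θ(p) = {⟨n,e⟩ | n ∈ B, e ∈ (A → p) for some A ∈ θ(n)}`. -/
def Gtheta (B : Set ℕ) (θ : ℕ → Set (Set ℕ)) (p : Set ℕ) : Set ℕ :=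
  {z | ∃ n ∈ B, ∃ e, z = Nat.pair n e ∧ ∃ A ∈ θ n, e ∈ setImp A p}

/-- `G_𝒜(p) = ⋃_{A ∈ 𝒜} (A → p)`. -/
def GA (𝒜 : Set (Set ℕ)) (p : Set ℕ) : Set ℕ := ⋃ A ∈ 𝒜, setImp A p

/-- `𝒜 ≤_L ℬ`: the ordering of basic local operators. -/
def leL (𝒜 ℬ : Set (Set ℕ)) : Prop := ∃ z : ℕ, ∀ A ∈ 𝒜, z ∈ L' (GA ℬ) A

/-- `𝒜` has the `n`-intersection property. -/
def nIntProp (𝒜 : Set (Set ℕ)) (n : ℕ) : Prop :=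
  ∀ A : Fin n → Set ℕ, (∀ i, A i ∈ 𝒜) → (⋂ i, A i).Nonempty

/-- The segment `[α]`: `{1,…,α}` for finite `α`, and all of `ℕ` for `α = ω`. -/
def seg (α : ℕ∞) : Set ℕ :=
  WithTop.recTopCoe Set.univ (fun n => {k | 1 ≤ k ∧ k ≤ n}) α

/-- `O^α_m`: the co-`m`-tons in `[α]`. -/
def Oam (α : ℕ∞) (m : ℕ) : Set (Set ℕ) :=
  {X | X ⊆ seg α ∧ (seg α \ X).Finite ∧ (seg α \ X).ncard = m}

/-- Characteristic function: `0` on `D`, `1` off `D`. -/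
noncomputable def chiD (D : Set ℕ) : ℕ → ℕ := fun n => if n ∈ D then 0 else 1

/-- A partial recursive function given by a code, with value `u` on one r.e. set and `v` on another
one disjoint from it. -/
theorem exists_kleene_separating {C D : Set ℕ} (hC : REPred (· ∈ C)) (hD : REPred (· ∈ D))
    (hCD : C ∩ D = ∅) (u v : ℕ) :
    ∃ e : ℕ, (∀ a ∈ C, u ∈ kleene e a) ∧ ∀ a ∈ D, v ∈ kleene e a := by
  have partrec_const : ∀ {E : Set ℕ}, REPred (· ∈ E) → ∀ w : ℕ,
      Partrec fun a : ℕ => (Part.assert (a ∈ E) fun _ => Part.some ()).map fun _ => w :=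
    fun hE w => Partrec.map hE (Computable.const w).to₂
  obtain ⟨k, hk, hkmem⟩ := Partrec.merge (partrec_const hC u) (partrec_const hD v) (by
    intro a x hx y hy
    simp only [Part.mem_map_iff, Part.mem_assert_iff] at hx hy
    obtain ⟨_, ⟨ha, _⟩, _⟩ := hx
    obtain ⟨_, ⟨ha', _⟩, _⟩ := hy
    exact absurd (show a ∈ C ∩ D from ⟨ha, ha'⟩) (by simp [hCD]))
  obtain ⟨c, hc⟩ := Nat.Partrec.Code.exists_code.1 (Partrec.nat_iff.1 hk)
  refine ⟨Encodable.encode c, fun a ha => ?_, fun a ha => ?_⟩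
  · rw [kleene, Denumerable.ofNat_encode, hc, hkmem]
    exact Or.inl (by simpa [Part.mem_assert_iff] using ha)
  · rw [kleene, Denumerable.ofNat_encode, hc, hkmem]
    exact Or.inr (by simpa [Part.mem_assert_iff] using ha)

/-- A code mapping a member of `𝒜` into `{0} ∧ p` yields an element of `L'(G_𝒜)(p)`. -/
theorem pair_one_mem_L' {𝒜 : Set (Set ℕ)} {A p : Set ℕ} (hA : A ∈ 𝒜) {e : ℕ}
    (he : e ∈ setImp A (setAnd {0} p)) : Nat.pair 1 e ∈ L' (GA 𝒜) p := by
  rintro q ⟨h0, h1⟩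
  refine h1 ⟨1, rfl, e, Set.mem_biUnion hA fun a ha => ?_, rfl⟩
  obtain ⟨v, hv, hvp⟩ := he a ha
  exact ⟨v, hv, h0 hvp⟩

/-- Corollary 3.2: if `𝒜` contains two r.e.-separable sets then
`¬¬ = L(G_{{0},{1}}) ≤ L(G_𝒜)`. -/
theorem stmt9 (𝒜 : Set (Set ℕ)) (h𝒜 : 𝒜.Nonempty)
    (A₁ A₂ : Set ℕ) (hA₁ : A₁ ∈ 𝒜) (hA₂ : A₂ ∈ 𝒜)
    (C D : Set ℕ) (hC : REPred (· ∈ C)) (hD : REPred (· ∈ D))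
    (hCD : C ∩ D = ∅) (h1 : A₁ ⊆ C) (h2 : A₂ ⊆ D) :
    leL {({0} : Set ℕ), ({1} : Set ℕ)} 𝒜 := by
  obtain ⟨e, he1, he2⟩ := exists_kleene_separating hC hD hCD (Nat.pair 0 0) (Nat.pair 0 1)
  refine ⟨Nat.pair 1 e, ?_⟩
  rintro A (rfl | rfl)
  · exact pair_one_mem_L' hA₁ fun a ha => ⟨_, he1 a (h1 ha), 0, rfl, 0, rfl, rfl⟩
  · exact pair_one_mem_L' hA₂ fun a ha => ⟨_, he2 a (h2 ha), 0, rfl, 1, rfl, rfl⟩
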